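/- arXiv:2301.11123 — 3 statements merged into one kernel-verified Lean document; each statement's English description precedes it below -/
import Mathlib

section
/- Let M, L ∈ ℝ^{n×n} be symmetric with L invertible, let Δt > 0, k_BT > 0, c ∈ ℝ, and suppose I + c Δt M L is invertible. Then for a symmetric matrix Σ ∈ ℝ^{n×n}, the fixed-point identity k_BT L⁻¹ = (I + cΔt M L)⁻¹ [ (I − (1−c)Δt M L)(k_BT L⁻¹)(I − (1−c)Δt L M) + Δt² Σ ] (I + cΔt L M)⁻¹ holds if and only if Σ = (2k_BT/Δt) M + (2c−1) k_BT M L M. -/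
theorem expand_aux {n : ℕ} (M L : Matrix (Fin n) (Fin n) ℝ) (hL : IsUnit L) (a k : ℝ) :
    (1 + a • (M * L)) * (k • L⁻¹) * (1 + a • (L * M)) =
      k • L⁻¹ + (2 * a * k) • M + (k * a ^ 2) • (M * L * M) := by
  have hd : IsUnit L.det := (Matrix.isUnit_iff_isUnit_det L).1 hL
  have h1 : M * L * L⁻¹ = M := Matrix.mul_nonsing_inv_cancel_right L M hd
  have h2 : L⁻¹ * (L * M) = M := Matrix.nonsing_inv_mul_cancel_left L M hd
  have h3 : (1 + a • (M * L)) * (k • L⁻¹) = k • L⁻¹ + (a * k) • M := by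
    rw [add_mul, one_mul, smul_mul_smul_comm, h1]
  rw [h3, mul_add, mul_one, add_mul, smul_mul_smul_comm, smul_mul_smul_comm, h2, ← mul_assoc M L M]
  module

/-- The equilibrium covariance `k_BT L⁻¹` is a fixed point of the linearized
implicit-explicit update if and only if the forcing covariance `Σ` equals
`(2 k_BT/Δt) M + (2c−1) k_BT M L M`. -/
theorem implicit_scheme_covariance_fixed_point_iff {n : ℕ}
    (M L S : Matrix (Fin n) (Fin n) ℝ)
    (hM : M.IsSymm) (hL : L.IsSymm) (hS : S.IsSymm)
    (hLinv : IsUnit L) (Δt kT c : ℝ) (hΔt : 0 < Δt) (hkT : 0 < kT)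
    (hinv : IsUnit (1 + (c * Δt) • (M * L))) :
    (kT • L⁻¹ =
      (1 + (c * Δt) • (M * L))⁻¹ *
        ((1 - ((1 - c) * Δt) • (M * L)) * (kT • L⁻¹) * (1 - ((1 - c) * Δt) • (L * M)) +
          (Δt ^ 2) • S) *
        (1 + (c * Δt) • (L * M))⁻¹) ↔
    S = (2 * kT / Δt) • M + ((2 * c - 1) * kT) • (M * L * M) := by
  have hd := (Matrix.isUnit_iff_isUnit_det _).1 hinv
  have hT : (1 + (c * Δt) • (M * L)).transpose = 1 + (c * Δt) • (L * M) := by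
    simp [Matrix.transpose_mul, hM.eq, hL.eq]
  have hd2 : IsUnit (1 + (c * Δt) • (L * M)).det := by
    rw [← hT, Matrix.det_transpose]; exact hd
  have e1 := expand_aux M L hLinv (c * Δt) kT
  have e2 := expand_aux M L hLinv (-((1 - c) * Δt)) kT
  simp only [neg_smul, ← sub_eq_add_neg] at e2
  rw [e2]
  generalize 1 + (c * Δt) • (M * L) = A at *
  generalize 1 + (c * Δt) • (L * M) = B at *
  have hne : Δt ≠ 0 := hΔt.ne'
  have key : ∀ K X : Matrix (Fin n) (Fin n) ℝ, K = A⁻¹ * X * B⁻¹ ↔ A * K * B = X := by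
    intro K X
    constructor
    · rintro rfl
      rw [mul_assoc A, Matrix.nonsing_inv_mul_cancel_right _ _ hd2,
        Matrix.mul_nonsing_inv_cancel_left _ _ hd]
    · rintro rfl
      rw [mul_assoc A, Matrix.nonsing_inv_mul_cancel_left _ _ hd,
        Matrix.mul_nonsing_inv_cancel_right _ _ hd2]
  rw [key, e1]
  have h4 : (Δt ^ 2) • ((2 * kT / Δt) • M + ((2 * c - 1) * kT) • (M * L * M)) =
      (2 * Δt * kT) • M + (Δt ^ 2 * ((2 * c - 1) * kT)) • (M * L * M) := by
    rw [smul_add, smul_smul, smul_smul]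
    congr 2
    field_simp
  have hne2 : Δt ^ 2 ≠ 0 := pow_ne_zero 2 hne
  constructor
  · intro h
    apply smul_right_injective _ hne2
    simp only
    rw [h4, ← sub_eq_zero]
    rw [← sub_eq_zero] at h
    rw [← neg_eq_zero, ← h]
    module
  · rintro rfl
    rw [h4]
    module
end

section
/- Let M ∈ ℝ^{n×n} be symmetric positive definite, K ∈ ℝ^{n×m}, L ∈ ℝ^{n×n}, and X ∈ ℝⁿ. Set A = Kᵀ M⁻¹ K and let N ∈ ℝ^{m×m} be the Moore–Penrose pseudoinverse of A, i.e., N satisfies A N A = A, N A N = N, (A N)ᵀ = A N, and (N A)ᵀ = N A. Define α = −N Kᵀ L X and Λ = M⁻¹ K α + L X. Then (α, Λ) solves the saddle-point system: K α = M(−L X + Λ) and Kᵀ Λ = 0. -/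
open Matrix

/-- Schur-complement elimination of the Lagrange multiplier: with
`N = (Kᵀ M⁻¹ K)†`, setting `α = −N Kᵀ L X` and `Λ = M⁻¹ K α + L X` solves the
saddle-point system `K α = M(−L X + Λ)`, `Kᵀ Λ = 0`. -/
theorem schur_complement_solves_saddle_point {n m : ℕ}
    (M : Matrix (Fin n) (Fin n) ℝ) (hM : M.PosDef)
    (K : Matrix (Fin n) (Fin m) ℝ) (L : Matrix (Fin n) (Fin n) ℝ) (X : Fin n → ℝ)
    (N : Matrix (Fin m) (Fin m) ℝ)
    (h1 : (Kᵀ * M⁻¹ * K) * N * (Kᵀ * M⁻¹ * K) = Kᵀ * M⁻¹ * K)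
    (h2 : N * (Kᵀ * M⁻¹ * K) * N = N)
    (h3 : ((Kᵀ * M⁻¹ * K) * N)ᵀ = (Kᵀ * M⁻¹ * K) * N)
    (h4 : (N * (Kᵀ * M⁻¹ * K))ᵀ = N * (Kᵀ * M⁻¹ * K))
    (α : Fin m → ℝ) (Λ : Fin n → ℝ)
    (hα : α = -(N * Kᵀ * L).mulVec X)
    (hΛ : Λ = (M⁻¹ * K).mulVec α + L.mulVec X) :
    K.mulVec α = M.mulVec (-(L.mulVec X) + Λ) ∧ Kᵀ.mulVec Λ = 0 := by
  have hdet : IsUnit M.det := hM.det_pos.ne'.isUnit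
  have hMi : (M⁻¹).PosDef := hM.inv
  have hMt : (M⁻¹)ᵀ = M⁻¹ := by
    have h := hMi.isHermitian.eq
    rwa [conjTranspose_eq_transpose_of_trivial] at h
  have hA : (Kᵀ * M⁻¹ * K)ᵀ = Kᵀ * M⁻¹ * K := by
    simp [transpose_mul, hMt, Matrix.mul_assoc]
  -- `A P = A` for the projector `P = A N`
  have hAP : (Kᵀ * M⁻¹ * K) * ((Kᵀ * M⁻¹ * K) * N) = Kᵀ * M⁻¹ * K := by
    have h := congrArg transpose h1
    rwa [transpose_mul, h3, hA] at h
  -- `K P = K`, because `M⁻¹` is positive definite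
  have hKP : K * ((Kᵀ * M⁻¹ * K) * N) = K := by
    generalize (Kᵀ * M⁻¹ * K) * N = P at hAP
    have hQ : (Kᵀ * M⁻¹ * K) * (P - 1) = 0 := by
      rw [Matrix.mul_sub, hAP, Matrix.mul_one, sub_self]
    have hKQ : K * (P - 1) = 0 := by
      apply Matrix.ext_of_mulVec_single
      intro i
      rw [Matrix.zero_mulVec]
      generalize (Pi.single i 1 : Fin m → ℝ) = v
      by_contra hne
      have hpos := hMi.dotProduct_mulVec_pos hne
      have hz : star ((K * (P - 1)) *ᵥ v) ⬝ᵥ (M⁻¹ *ᵥ ((K * (P - 1)) *ᵥ v)) = 0 := by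
        rw [star_trivial]
        nth_rewrite 1 [← Matrix.mulVec_mulVec]
        rw [← Matrix.vecMul_transpose, ← Matrix.dotProduct_mulVec, Matrix.mulVec_mulVec,
          Matrix.mulVec_mulVec, ← Matrix.mul_assoc, hQ,
          Matrix.zero_mulVec, dotProduct_zero]
      exact hpos.ne' hz
    rw [Matrix.mul_sub, Matrix.mul_one] at hKQ
    exact sub_eq_zero.mp hKQ
  have hPK : (Kᵀ * M⁻¹ * K) * N * Kᵀ = Kᵀ := by
    have h := congrArg transpose hKP
    rwa [transpose_mul, h3] at h
  constructor
  · rw [hΛ, add_comm, add_neg_cancel_right, Matrix.mulVec_mulVec,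
      Matrix.mul_nonsing_inv_cancel_left _ _ hdet]
  · have h : Kᵀ * (M⁻¹ * K) * (N * Kᵀ * L) = Kᵀ * L := by
      calc _ = (Kᵀ * M⁻¹ * K) * N * Kᵀ * L := by simp only [Matrix.mul_assoc]
        _ = _ := by rw [hPK]
    rw [hΛ, hα, Matrix.mulVec_add, Matrix.mulVec_mulVec, Matrix.mulVec_neg,
      Matrix.mulVec_mulVec, Matrix.mulVec_mulVec, h, neg_add_cancel]
end

section
/- Let μ > 0, let X : ℝ → ℝ³ be twice continuously differentiable, let f : ℝ → ℝ³ be continuously differentiable, and let s ∈ ℝ with X'(s) ≠ 0; write τ̂ = X'(s)/‖X'(s)‖. For s' ≠ s with X(s') ≠ X(s), define g(s') = [ S(X(s), X(s')) f(s') − S₁(s, s') f(s) ] · |s'−s|/(s'−s) (a vector in ℝ³, where · denotes scalar multiplication by |s'−s|/(s'−s)). Then as s' → s through such values, g(s') converges to (1/(8πμ)) [ (1/(2‖X'(s)‖³)) ( X'(s)X''(s)ᵀ + X''(s)X'(s)ᵀ − (X'(s)·X''(s)) (I + 3 τ̂ τ̂ᵀ) ) f(s) + ( (I + τ̂ τ̂ᵀ)/‖X'(s)‖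 ) f'(s) ]. -/
open Matrix

/-- Euclidean dot product on `ℝ³` (as `Fin 3 → ℝ`). -/
def dot3 (u v : Fin 3 → ℝ) : ℝ := ∑ i, u i * v i

/-- Euclidean norm on `ℝ³` (as `Fin 3 → ℝ`). -/
noncomputable def enorm3 (v : Fin 3 → ℝ) : ℝ := Real.sqrt (∑ i, v i ^ 2)

/-- The Stokeslet kernel `S(x,y) = (1/(8πμ)) (I + r̂ r̂ᵀ)/‖r‖`, where `r = x − y`
and `r̂ = r/‖r‖`. -/
noncomputable def stokeslet (μ : ℝ) (x y : Fin 3 → ℝ) : Matrix (Fin 3) (Fin 3) ℝ :=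
  (1 / (8 * Real.pi * μ)) •
    ((enorm3 (x - y))⁻¹ •
      (1 + Matrix.vecMulVec ((enorm3 (x - y))⁻¹ • (x - y)) ((enorm3 (x - y))⁻¹ • (x - y))))

/-- The leading-order singularity of the Stokeslet along the curve:
`S₁(s,s') = (1/(8πμ)) (I + τ̂ τ̂ᵀ)/(‖X'(s)‖ |s−s'|)`, where `Xp = X'(s)` and
`τ̂ = Xp/‖Xp‖`. -/
noncomputable def stokesletSing (μ : ℝ) (Xp : Fin 3 → ℝ) (s s' : ℝ) :
    Matrix (Fin 3) (Fin 3) ℝ :=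
  (1 / (8 * Real.pi * μ)) •
    ((enorm3 Xp * |s - s'|)⁻¹ •
      (1 + Matrix.vecMulVec ((enorm3 Xp)⁻¹ • Xp) ((enorm3 Xp)⁻¹ • Xp)))

/-- The claimed limit of the subtracted Stokeslet integrand:
`(1/(8πμ)) [ (1/(2‖X'‖³)) ( X'X''ᵀ + X''X'ᵀ − (X'·X'')(I + 3τ̂τ̂ᵀ) ) f(s)
  + ((I + τ̂τ̂ᵀ)/‖X'‖) f'(s) ]`, where `Xp = X'(s)`, `Xpp = X''(s)`,
`fs = f(s)`, `fps = f'(s)`. -/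
noncomputable def stokesletLimit (μ : ℝ) (Xp Xpp fs fps : Fin 3 → ℝ) : Fin 3 → ℝ :=
  let th : Fin 3 → ℝ := (enorm3 Xp)⁻¹ • Xp
  (1 / (8 * Real.pi * μ)) •
    ((1 / (2 * enorm3 Xp ^ 3)) •
        (Matrix.vecMulVec Xp Xpp + Matrix.vecMulVec Xpp Xp
          - dot3 Xp Xpp • (1 + (3 : ℝ) • Matrix.vecMulVec th th)).mulVec fs
      + ((enorm3 Xp)⁻¹ • (1 + Matrix.vecMulVec th th)).mulVec fps)

lemma dslope_second (x x' : ℝ → ℝ) (a s : ℝ) (hx : ∀ t, HasDerivAt x (x' t) t)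
    (hx' : HasDerivAt x' a s) : HasDerivAt (dslope x s) (a / 2) s := by
  rw [hasDerivAt_iff_tendsto_slope]
  have h := HasDerivAt.lhopital_zero_nhdsNE (a := s) (l := nhds (a / 2))
    (f := fun t => x t - x s - (t - s) * x' s) (f' := fun t => x' t - x' s)
    (g := fun t => (t - s) ^ 2) (g' := fun t => 2 * (t - s)) ?_ ?_ ?_ ?_ ?_ ?_
  · refine h.congr' ?_
    filter_upwards [self_mem_nhdsWithin] with t ht
    have ht' : t - s ≠ 0 := sub_ne_zero.mpr ht
    rw [slope_def_field, dslope_of_ne _ ht, dslope_same, slope_def_field, (hx s).deriv]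
    field_simp
  · refine Filter.Eventually.of_forall fun t => ?_
    have := ((hx t).sub_const (x s)).fun_sub (((hasDerivAt_id t).sub_const s).mul_const (x' s))
    simpa using this
  · refine Filter.Eventually.of_forall fun t => ?_
    have := ((hasDerivAt_id t).sub_const s).fun_pow 2
    simpa using this
  · filter_upwards [self_mem_nhdsWithin] with t ht
    have ht' : t - s ≠ 0 := sub_ne_zero.mpr ht
    positivity
  · have hc : ContinuousAt (fun t => x t - x s - (t - s) * x' s) s := by
      have := (hx s).continuousAt
      fun_prop
    have := hc.tendsto
    simp only [sub_self, zero_mul] at this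
    exact this.mono_left nhdsWithin_le_nhds
  · have hc : ContinuousAt (fun t : ℝ => (t - s) ^ 2) s := by fun_prop
    have := hc.tendsto
    simp only [sub_self] at this
    norm_num at this
    exact this.mono_left nhdsWithin_le_nhds
  · have h2 := (hasDerivAt_iff_tendsto_slope.mp hx').div_const 2
    refine h2.congr fun t => ?_
    rw [slope_def_field, div_div, mul_comm]

/-- Regularised kernel applied to a vector. -/
noncomputable def regK (c : ℝ) (q v : Fin 3 → ℝ) : Fin 3 → ℝ := fun i =>
  c * ((enorm3 q)⁻¹ * v i + (enorm3 q)⁻¹ ^ 3 * (q i * dot3 q v))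

lemma regK_eq (c d : ℝ) (q v : Fin 3 → ℝ) :
    (c • (((enorm3 q * d)⁻¹) • ((1 : Matrix (Fin 3) (Fin 3) ℝ) +
      Matrix.vecMulVec ((enorm3 q)⁻¹ • q) ((enorm3 q)⁻¹ • q)))).mulVec v
      = d⁻¹ • regK c q v := by
  simp only [Matrix.smul_mulVec, Matrix.add_mulVec, Matrix.one_mulVec, Matrix.vecMulVec_mulVec]
  ext i
  simp [regK, dot3, dotProduct, Fin.sum_univ_three]
  ring

lemma enorm3_smul (a : ℝ) (v : Fin 3 → ℝ) : enorm3 (a • v) = |a| * enorm3 v := by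
  unfold enorm3
  rw [← Real.sqrt_sq_eq_abs, ← Real.sqrt_mul (sq_nonneg a)]
  simp [mul_pow, Finset.mul_sum]

lemma stokeslet_eq (μ h : ℝ) (hh : h ≠ 0) (x y q v : Fin 3 → ℝ) (hxy : y - x = h • q) :
    (stokeslet μ x y).mulVec v = |h|⁻¹ • regK (1 / (8 * Real.pi * μ)) q v := by
  have h1 : x - y = (-h) • q := by rw [neg_smul, ← hxy]; abel
  have h2 : enorm3 (x - y) = enorm3 q * |h| := by rw [h1, enorm3_smul, abs_neg, mul_comm]
  rw [← regK_eq]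
  unfold stokeslet
  rw [h2, h1]
  congr 4
  ext i j
  simp only [Matrix.vecMulVec_apply, Pi.smul_apply, smul_eq_mul, mul_inv]
  have : |h|⁻¹ * |h|⁻¹ * (h * h) = 1 := by
    rw [← mul_inv, abs_mul_abs_self]; field_simp
  linear_combination ((enorm3 q)⁻¹ * q i * ((enorm3 q)⁻¹ * q j)) * this

lemma enorm3_pos (v : Fin 3 → ℝ) (hv : v ≠ 0) : 0 < ∑ i, v i ^ 2 := by
  obtain ⟨i, hi⟩ := Function.ne_iff.mp hv
  exact Finset.sum_pos' (fun j _ => sq_nonneg _)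
    ⟨i, Finset.mem_univ _, by simpa using pow_pos (abs_pos.mpr hi) 2⟩

lemma regK_hasDerivAt (c s : ℝ) (q v : ℝ → Fin 3 → ℝ) (q' v' : Fin 3 → ℝ)
    (hq : HasDerivAt q q' s) (hv : HasDerivAt v v' s) (h0 : q s ≠ 0) (i : Fin 3) :
    HasDerivAt (fun t => regK c (q t) (v t) i)
      (c * (-(dot3 (q s) q') / enorm3 (q s) ^ 3 * v s i + (enorm3 (q s))⁻¹ * v' i
        + (-3 * dot3 (q s) q' / enorm3 (q s) ^ 5 * (q s i * dot3 (q s) (v s))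
        + (enorm3 (q s))⁻¹ ^ 3 * (q' i * dot3 (q s) (v s)
          + q s i * (dot3 q' (v s) + dot3 (q s) v'))))) s := by
  have hqi := hasDerivAt_pi.mp hq
  have hvi := hasDerivAt_pi.mp hv
  have hp := enorm3_pos _ h0
  have hn : 0 < enorm3 (q s) := Real.sqrt_pos.mpr hp
  have hS : HasDerivAt (fun t => ∑ j, q t j ^ 2) (2 * dot3 (q s) q') s := by
    have := HasDerivAt.fun_sum (u := Finset.univ) fun j _ => (hqi j).fun_pow 2
    refine this.congr_deriv ?_
    simp [dot3, Fin.sum_univ_three]; ring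
  have hm : HasDerivAt (fun t => (enorm3 (q t))⁻¹) (-(dot3 (q s) q') / enorm3 (q s) ^ 3) s := by
    have := (hS.sqrt hp.ne').fun_inv hn.ne'
    refine this.congr_deriv ?_
    change -(2 * dot3 (q s) q' / (2 * enorm3 (q s))) / enorm3 (q s) ^ 2 = _
    field_simp
  have hD : HasDerivAt (fun t => dot3 (q t) (v t)) (dot3 q' (v s) + dot3 (q s) v') s := by
    have := HasDerivAt.fun_sum (u := Finset.univ) fun j _ => (hqi j).fun_mul (hvi j)
    refine this.congr_deriv ?_
    simp [dot3, Finset.sum_add_distrib]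
  have := ((hm.fun_mul (hvi i)).fun_add ((hm.fun_pow 3).fun_mul ((hqi i).fun_mul hD))).const_mul c
  refine this.congr_deriv ?_
  push_cast
  field_simp

/-- The subtracted Stokeslet integrand
`g(s') = [S(X(s),X(s')) f(s') − S₁(s,s') f(s)] · |s'−s|/(s'−s)` extends
continuously to `s' = s`, with the stated limit. -/
theorem subtracted_stokeslet_integrand_limit (μ : ℝ) (hμ : 0 < μ)
    (X f : ℝ → Fin 3 → ℝ) (hX : ContDiff ℝ 2 X) (hf : ContDiff ℝ 1 f)
    (s : ℝ) (hXp : deriv X s ≠ 0) :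
    Filter.Tendsto
      (fun s' : ℝ => (|s' - s| / (s' - s)) •
        ((stokeslet μ (X s) (X s')).mulVec (f s')
          - (stokesletSing μ (deriv X s) s s').mulVec (f s)))
      (nhdsWithin s {s' | s' ≠ s ∧ X s' ≠ X s})
      (nhds (stokesletLimit μ (deriv X s) (deriv (deriv X) s) (f s) (deriv f s))) := by
  
  set q : ℝ → Fin 3 → ℝ := fun t i => dslope (fun u => X u i) s t with hqdef
  have hX1 : ∀ t, HasDerivAt X (deriv X t) t := fun t =>
    (hX.differentiable (by norm_num) t).hasDerivAt
  have hX2 : HasDerivAt (deriv X) (deriv (deriv X) s) s := by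
    have : ContDiff ℝ 1 (deriv X) := by
      have h : ContDiff ℝ (1 + 1) X := by
        convert hX using 1
        norm_num
      exact (contDiff_succ_iff_deriv.mp h).2.2
    exact (this.differentiable (by norm_num) s).hasDerivAt
  have hf1 : HasDerivAt f (deriv f s) s := (hf.differentiable (by norm_num) s).hasDerivAt
  have hq : HasDerivAt q ((1 / 2 : ℝ) • deriv (deriv X) s) s := by
    rw [hasDerivAt_pi]
    intro i
    have := dslope_second (fun u => X u i) (fun u => deriv X u i) (deriv (deriv X) s i) s
      (fun t => hasDerivAt_pi.mp (hX1 t) i) (hasDerivAt_pi.mp hX2 i)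
    refine this.congr_deriv ?_
    simp; ring
  have hqs : q s = deriv X s := by
    ext i
    simp only [hqdef, dslope_same]
    exact (hasDerivAt_pi.mp (hX1 s) i).deriv
  have hn : enorm3 (deriv X s) ≠ 0 := (Real.sqrt_pos.mpr (enorm3_pos _ hXp)).ne'
  rw [tendsto_pi_nhds]
  intro i
  have hD := regK_hasDerivAt (1 / (8 * Real.pi * μ)) s q f _ _ hq hf1 (hqs ▸ hXp) i
  have hT := (hasDerivAt_iff_tendsto_slope.mp hD).mono_left
    (nhdsWithin_mono s (show {s' | s' ≠ s ∧ X s' ≠ X s} ⊆ {s}ᶜ from fun t ht => ht.1))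
  have key : ∀ L L' : ℝ, L = L' → ∀ F G : ℝ → ℝ,
      Filter.Tendsto F (nhdsWithin s {s' | s' ≠ s ∧ X s' ≠ X s}) (nhds L) →
      F =ᶠ[nhdsWithin s {s' | s' ≠ s ∧ X s' ≠ X s}] G →
      Filter.Tendsto G (nhdsWithin s {s' | s' ≠ s ∧ X s' ≠ X s}) (nhds L') := by
    rintro L _ rfl F G h1 h2
    exact h1.congr' h2
  refine key _ _ ?_ _ _ hT ?_
  · rw [hqs]
    simp only [stokesletLimit, Matrix.smul_mulVec, Matrix.add_mulVec, Matrix.sub_mulVec,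
      Matrix.one_mulVec, Matrix.vecMulVec_mulVec]
    generalize 1 / (8 * Real.pi * μ) = c
    simp [dot3, dotProduct, Fin.sum_univ_three, -mul_eq_mul_left_iff]
    field_simp
    ring
  · filter_upwards [self_mem_nhdsWithin] with t ht
    have hts : t - s ≠ 0 := sub_ne_zero.mpr ht.1
    have hxy : X t - X s = (t - s) • q t := by
      ext j
      simp only [hqdef, dslope_of_ne _ ht.1, slope_def_field, Pi.sub_apply, Pi.smul_apply,
        smul_eq_mul]
      field_simp
    rw [stokeslet_eq μ (t - s) hts _ _ (q t) (f t) hxy]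
    unfold stokesletSing
    rw [regK_eq, slope_def_field, hqs, abs_sub_comm s t]
    have : |t - s| ≠ 0 := abs_ne_zero.mpr hts
    simp only [Pi.sub_apply, Pi.smul_apply, smul_eq_mul]
    field_simp
end
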